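/- Let R be the set of eleven rewrite rules on binary trees given in the context. Every ≡_3-equivalence class of binary trees contains exactly one binary tree that avoids all eleven binary trees appearing as left members of rules of R; i.e., the trees avoiding these eleven left members form a system of representatives (a Poincaré–Birkhoff–Witt basis) of the 3-comb associative operad CAs_3. -/

import Mathlib

/-- A binary tree: either a leaf or an ordered pair of binary trees. -/
inductive BTree : Type
  | leaf : BTree
  | node : BTree → BTree → BTree
  deriving DecidableEq

namespace BTree

/-- The arity of a binary tree is its number of leaves. -/
def arity : BTree → ℕ
  | leaf => 1
  | node l r => arity l + arity r

/-- The degree of a binary tree is its number of internal nodes. -/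
def degree : BTree → ℕ
  | leaf => 0
  | node l r => degree l + degree r + 1

/-- Grafting `t ∘ᵢ s`: identify the root of `s` with the `i`-th leaf of `t`
(leaves numbered from left to right, starting at `1`). -/
def graft : BTree → ℕ → BTree → BTree
  | leaf, i, s => if i = 1 then s else leaf
  | node l r, i, s =>
      if i ≤ l.arity then node (l.graft i s) r else node l (r.graft (i - l.arity) s)

/-- Simultaneous grafting `s ∘ [r_1, …, r_n]`: graft the `i`-th element of the
list onto the `i`-th leaf of `s`, simultaneously. -/
def multigraft : BTree → List BTree → BTree
  | leaf, rs => rs.headD leaf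
  | node l r, rs => node (l.multigraft (rs.take l.arity)) (r.multigraft (rs.drop l.arity))

/-- The left comb with `γ` internal nodes. -/
def leftComb : ℕ → BTree
  | 0 => leaf
  | γ + 1 => node (leftComb γ) leaf

/-- The right comb with `γ` internal nodes. -/
def rightComb : ℕ → BTree
  | 0 => leaf
  | γ + 1 => node leaf (rightComb γ)

/-- The prefix word of a binary tree, over the alphabet `{0, 2}`:
a left-to-right depth-first traversal writes `2` for each internal node and
`0` for each leaf. -/
def prefixWord : BTree → List ℕ
  | leaf => [0]
  | node l r => 2 :: (prefixWord l ++ prefixWord r)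

/-- The left rank: number of internal nodes on the leftmost branch from the root. -/
def leftRank : BTree → ℕ
  | leaf => 0
  | node l _ => leftRank l + 1

/-- The mirror of a binary tree. -/
def mirror : BTree → BTree
  | leaf => leaf
  | node l r => node (mirror r) (mirror l)

end BTree

/-- One step of the rewrite relation induced by a set of rewrite rules `R`:
`r ∘ᵢ (s ∘ [r_1, …, r_n]) ⇒ r ∘ᵢ (s' ∘ [r_1, …, r_n])` whenever `R s s'`. -/
def Step (R : BTree → BTree → Prop) (t t' : BTree) : Prop :=
  ∃ (s s' r : BTree) (i : ℕ) (rs : List BTree),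
    R s s' ∧ 1 ≤ i ∧ i ≤ r.arity ∧ rs.length = s.arity ∧
    t = r.graft i (s.multigraft rs) ∧ t' = r.graft i (s'.multigraft rs)

/-- The congruence generated by a set of rewrite rules: the reflexive–symmetric–transitive
closure of the induced rewrite relation. -/
def CongrGen (R : BTree → BTree → Prop) : BTree → BTree → Prop :=
  Relation.EqvGen (Step R)

/-- The tree `s` occurs as a subtree of `t`. -/
def Occurs (s t : BTree) : Prop :=
  ∃ (r : BTree) (i : ℕ) (rs : List BTree),
    1 ≤ i ∧ i ≤ r.arity ∧ rs.length = s.arity ∧ t = r.graft i (s.multigraft rs)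

/-- The rewrite relation induced by `R` is terminating: there is no infinite
chain `t_0 ⇒ t_1 ⇒ t_2 ⇒ ⋯`. -/
def Terminating (R : BTree → BTree → Prop) : Prop :=
  ¬ ∃ f : ℕ → BTree, ∀ n, Step R (f n) (f (n + 1))

/-- The rewrite relation induced by `R` is confluent. -/
def Confluent (R : BTree → BTree → Prop) : Prop :=
  ∀ t s₁ s₂, Relation.ReflTransGen (Step R) t s₁ → Relation.ReflTransGen (Step R) t s₂ →
    ∃ t', Relation.ReflTransGen (Step R) s₁ t' ∧ Relation.ReflTransGen (Step R) s₂ t'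

/-- The number of equivalence classes of binary trees of arity `n` under the
equivalence relation `E`. -/
noncomputable def classCount (E : BTree → BTree → Prop) (n : ℕ) : ℕ :=
  Nat.card (Quot fun a b : {t : BTree // t.arity = n} => E a.1 b.1)

/-- The congruence `≡_γ` generated by the single rewrite rule `(L_γ, R_γ)`. -/
def CAsCongr (γ : ℕ) : BTree → BTree → Prop :=
  CongrGen fun s s' => s = BTree.leftComb γ ∧ s' = BTree.rightComb γ

/-- The eleven rewrite rules of the convergent presentation of `CAs₃`,
given by the prefix words of their left and right members. -/
def Rules3 : BTree → BTree → Prop := fun s s' => (s, s') ∈ ([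
  ((.node (.node (.node .leaf .leaf) .leaf) .leaf),
   (.node .leaf (.node .leaf (.node .leaf .leaf)))),
  ((.node (.node .leaf (.node .leaf (.node .leaf .leaf))) .leaf),
   (.node (.node .leaf .leaf) (.node .leaf (.node .leaf .leaf)))),
  ((.node .leaf (.node .leaf (.node (.node .leaf (.node .leaf .leaf)) .leaf))),
   (.node .leaf (.node .leaf (.node .leaf (.node .leaf (.node .leaf .leaf)))))),
  ((.node .leaf (.node (.node .leaf (.node .leaf .leaf)) (.node .leaf .leaf))),
   (.node .leaf (.node .leaf (.node .leaf (.node .leaf (.node .leaf .leaf)))))),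
  ((.node .leaf (.node .leaf (.node (.node .leaf .leaf) (.node .leaf (.node .leaf .leaf))))),
   (.node .leaf (.node .leaf (.node .leaf (.node .leaf (.node (.node .leaf .leaf) .leaf)))))),
  ((.node .leaf (.node (.node .leaf .leaf) (.node .leaf (.node .leaf (.node .leaf .leaf))))),
   (.node .leaf (.node .leaf (.node .leaf (.node (.node .leaf .leaf) (.node .leaf .leaf)))))),
  ((.node (.node .leaf (.node (.node .leaf .leaf) .leaf)) (.node .leaf (.node .leaf .leaf))),
   (.node (.node .leaf .leaf) (.node .leaf (.node .leaf (.node .leaf (.node .leaf .leaf)))))),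
  ((.node .leaf (.node .leaf (.node .leaf (.node .leaf (.node (.node .leaf .leaf) (.node .leaf .leaf)))))),
   (.node .leaf (.node .leaf (.node .leaf (.node .leaf (.node .leaf (.node (.node .leaf .leaf) .leaf))))))),
  ((.node .leaf (.node .leaf (.node .leaf (.node (.node .leaf .leaf) (.node (.node .leaf .leaf) .leaf))))),
   (.node .leaf (.node .leaf (.node .leaf (.node .leaf (.node .leaf (.node .leaf (.node .leaf .leaf)))))))),
  ((.node (.node .leaf .leaf) (.node .leaf (.node .leaf (.node (.node .leaf .leaf) (.node .leaf .leaf))))),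
   (.node (.node .leaf .leaf) (.node .leaf (.node .leaf (.node .leaf (.node (.node .leaf .leaf) .leaf)))))),
  ((.node (.node .leaf (.node .leaf .leaf)) (.node .leaf (.node .leaf (.node .leaf (.node .leaf .leaf))))),
   (.node (.node .leaf .leaf) (.node .leaf (.node .leaf (.node .leaf (.node (.node .leaf .leaf) .leaf))))))
  ] : List (BTree × BTree))

namespace BTree

instance : Mul BTree := ⟨node⟩

/-- The eleven rules of `Rules3`, as a list. -/
def ruleList : List (BTree × BTree) :=
  let o := leaf
  [(((o * o) * o) * o, o * (o * (o * o))),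
   ((o * (o * (o * o))) * o, (o * o) * (o * (o * o))),
   (o * (o * ((o * (o * o)) * o)), o * (o * (o * (o * (o * o))))),
   (o * ((o * (o * o)) * (o * o)), o * (o * (o * (o * (o * o))))),
   (o * (o * ((o * o) * (o * (o * o)))), o * (o * (o * (o * ((o * o) * o))))),
   (o * ((o * o) * (o * (o * (o * o)))), o * (o * (o * ((o * o) * (o * o))))),
   ((o * ((o * o) * o)) * (o * (o * o)), (o * o) * (o * (o * (o * (o * o))))),
   (o * (o * (o * (o * ((o * o) * (o * o))))), o * (o * (o * (o * (o * ((o * o) * o)))))),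
   (o * (o * (o * ((o * o) * ((o * o) * o)))), o * (o * (o * (o * (o * (o * (o * o))))))),
   ((o * o) * (o * (o * ((o * o) * (o * o)))), (o * o) * (o * (o * (o * ((o * o) * o))))),
   ((o * (o * o)) * (o * (o * (o * (o * o)))), (o * o) * (o * (o * (o * ((o * o) * o)))))]

lemma mem_ruleList_iff {s s' : BTree} : (s, s') ∈ ruleList ↔ Rules3 s s' := Iff.rfl

lemma arity_eq_of_mem_ruleList : ∀ p ∈ ruleList, p.1.arity = p.2.arity := by
  decide

lemma arity_pos : ∀ t : BTree, 0 < t.arity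
  | leaf => Nat.one_pos
  | node l _ => Nat.add_pos_left (arity_pos l) _

/-! ### Simultaneous grafting -/

lemma multigraft_node_append {l r : BTree} {xs ys : List BTree} (h : xs.length = l.arity) :
    (node l r).multigraft (xs ++ ys) = node (l.multigraft xs) (r.multigraft ys) := by
  simp [multigraft, ← h]

lemma exists_append_of_length_eq_add {α : Type*} {xs : List α} {m n : ℕ}
    (h : xs.length = m + n) : ∃ ys zs, xs = ys ++ zs ∧ ys.length = m ∧ zs.length = n :=
  ⟨xs.take m, xs.drop m, (List.take_append_drop m xs).symm, by simp [h], by simp [h]⟩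

lemma arity_multigraft {u : BTree} {xs : List BTree} (h : xs.length = u.arity) :
    (u.multigraft xs).arity = (xs.map arity).sum := by
  induction u generalizing xs with
  | leaf =>
    obtain ⟨x, rfl⟩ := List.length_eq_one_iff.1 h
    simp [multigraft]
  | node l r ihl ihr =>
    obtain ⟨ys, zs, rfl, hy, hz⟩ := exists_append_of_length_eq_add h
    simp [multigraft_node_append hy, arity, ihl hy, ihr hz]

lemma multigraft_multigraft {u : BTree} {ps : List (BTree × List BTree)}
    (hps : ∀ p ∈ ps, p.2.length = p.1.arity) (h : ps.length = u.arity) :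
    (u.multigraft (ps.map Prod.fst)).multigraft (ps.flatMap Prod.snd) =
      u.multigraft (ps.map fun p => p.1.multigraft p.2) := by
  induction u generalizing ps with
  | leaf =>
    obtain ⟨x, rfl⟩ := List.length_eq_one_iff.1 h
    simp [multigraft]
  | node l r ihl ihr =>
    obtain ⟨ys, zs, rfl, hy, hz⟩ := exists_append_of_length_eq_add h
    simp only [List.mem_append, or_imp, forall_and] at hps
    have hlen : (ys.flatMap Prod.snd).length = (l.multigraft (ys.map Prod.fst)).arity := by
      rw [arity_multigraft (by simpa using hy), List.length_flatMap, List.map_map]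
      exact congrArg List.sum (List.map_congr_left hps.1)
    simp only [List.map_append, List.flatMap_append]
    rw [multigraft_node_append (by simpa using hy), multigraft_node_append hlen,
      multigraft_node_append (by simpa using hy), ihl hps.1 hy, ihr hps.2 hz]

/-! ### Prefixes of a tree -/

/-- Whether `t` is of the form `s ∘ [r_1, …, r_n]`. -/
def isPrefix : BTree → BTree → Bool
  | leaf, _ => true
  | node _ _, leaf => false
  | node l r, node l₂ r₂ => isPrefix l l₂ && isPrefix r r₂

/-- The list `[r_1, …, r_n]` such that `t = s ∘ [r_1, …, r_n]`, when `s` is a prefix of `t`. -/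
def cut : BTree → BTree → List BTree
  | leaf, t => [t]
  | node _ _, leaf => []
  | node l r, node l₂ r₂ => cut l l₂ ++ cut r r₂

/-- The least tree having both arguments as prefixes. -/
def merge : BTree → BTree → BTree
  | leaf, t => t
  | node l r, leaf => node l r
  | node l r, node l' r' => node (merge l l') (merge r r')

lemma exists_of_isPrefix_node {l r t : BTree} (h : isPrefix (node l r) t) :
    ∃ l' r', t = node l' r' ∧ isPrefix l l' ∧ isPrefix r r' := by
  cases t with
  | leaf => simp [isPrefix] at h
  | node l' r' => exact ⟨l', r', rfl, by simpa [isPrefix] using h⟩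

lemma isPrefix_refl (t : BTree) : isPrefix t t := by
  induction t <;> simp_all [isPrefix]

lemma isPrefix_trans {s m t : BTree} (h : isPrefix s m) (h' : isPrefix m t) : isPrefix s t := by
  induction s generalizing m t with
  | leaf => simp [isPrefix]
  | node l r ihl ihr =>
    obtain ⟨_, _, rfl, hl, hr⟩ := exists_of_isPrefix_node h
    obtain ⟨_, _, rfl, hl', hr'⟩ := exists_of_isPrefix_node h'
    simp [isPrefix, ihl hl hl', ihr hr hr']

lemma length_cut {s t : BTree} (h : isPrefix s t) : (cut s t).length = s.arity := by
  induction s generalizing t with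
  | leaf => simp [cut, arity]
  | node l r ihl ihr =>
    obtain ⟨_, _, rfl, hl, hr⟩ := exists_of_isPrefix_node h
    simp [cut, arity, ihl hl, ihr hr]

lemma multigraft_cut {s t : BTree} (h : isPrefix s t) : s.multigraft (cut s t) = t := by
  induction s generalizing t with
  | leaf => simp [cut, multigraft]
  | node l r ihl ihr =>
    obtain ⟨_, _, rfl, hl, hr⟩ := exists_of_isPrefix_node h
    rw [cut, multigraft_node_append (length_cut hl), ihl hl, ihr hr]

lemma isPrefix_multigraft (s : BTree) (xs : List BTree) : isPrefix s (s.multigraft xs) := by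
  induction s generalizing xs <;> simp_all [isPrefix, multigraft]

lemma cut_multigraft {s : BTree} {xs : List BTree} (h : xs.length = s.arity) :
    cut s (s.multigraft xs) = xs := by
  induction s generalizing xs with
  | leaf =>
    obtain ⟨x, rfl⟩ := List.length_eq_one_iff.1 h
    simp [multigraft, cut]
  | node l r ihl ihr =>
    obtain ⟨ys, zs, rfl, hy, hz⟩ := exists_append_of_length_eq_add h
    rw [multigraft_node_append hy, cut, ihl hy, ihr hz]

lemma exists_cut_eq_of_isPrefix {s m t : BTree} (h : isPrefix s m) (h' : isPrefix m t) :
    ∃ ps : List (BTree × List BTree), (∀ p ∈ ps, p.2.length = p.1.arity) ∧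
      cut s m = ps.map Prod.fst ∧ cut m t = ps.flatMap Prod.snd ∧
      cut s t = ps.map fun p => p.1.multigraft p.2 := by
  induction s generalizing m t with
  | leaf => exact ⟨[(m, cut m t)], by simp [length_cut h', cut, multigraft_cut h']⟩
  | node l r ihl ihr =>
    obtain ⟨_, _, rfl, hl, hr⟩ := exists_of_isPrefix_node h
    obtain ⟨_, _, rfl, hl', hr'⟩ := exists_of_isPrefix_node h'
    obtain ⟨ps, h1, h2, h3, h4⟩ := ihl hl hl'
    obtain ⟨qs, k1, k2, k3, k4⟩ := ihr hr hr'
    refine ⟨ps ++ qs, fun p hp => (List.mem_append.1 hp).elim (h1 p) (k1 p), ?_⟩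
    simp [cut, h2, h3, h4, k2, k3, k4]

lemma multigraft_cut_multigraft_cut {u s m t : BTree} (h : isPrefix s m) (h' : isPrefix m t)
    (hu : s.arity = u.arity) :
    (u.multigraft (cut s m)).multigraft (cut m t) = u.multigraft (cut s t) := by
  obtain ⟨ps, h1, h2, h3, h4⟩ := exists_cut_eq_of_isPrefix h h'
  have hlen : ps.length = u.arity := by
    rw [← hu, ← length_cut h, h2, List.length_map]
  rw [h2, h3, h4, multigraft_multigraft h1 hlen]

lemma arity_multigraft_cut {u s t : BTree} (h : isPrefix s t) (hu : s.arity = u.arity) :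
    (u.multigraft (cut s t)).arity = t.arity := by
  rw [arity_multigraft ((length_cut h).trans hu), ← arity_multigraft (length_cut h),
    multigraft_cut h]

lemma isPrefix_merge_left (s t : BTree) : isPrefix s (merge s t) := by
  induction s generalizing t with
  | leaf => simp [isPrefix]
  | node l r ihl ihr => cases t <;> simp [merge, isPrefix, isPrefix_refl, ihl, ihr]

lemma isPrefix_merge_right (s t : BTree) : isPrefix t (merge s t) := by
  induction s generalizing t with
  | leaf => simp [merge, isPrefix_refl]
  | node l r ihl ihr => cases t <;> simp [merge, isPrefix, ihl, ihr]

lemma merge_isPrefix {s s' t : BTree} (h : isPrefix s t) (h' : isPrefix s' t) :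
    isPrefix (merge s s') t := by
  induction s generalizing s' t with
  | leaf => simpa [merge] using h'
  | node l r ihl ihr =>
    cases s' with
    | leaf => simpa [merge] using h
    | node l₂ r₂ =>
      obtain ⟨_, _, rfl, hl, hr⟩ := exists_of_isPrefix_node h
      obtain ⟨hl₂, hr₂⟩ : isPrefix l₂ _ ∧ isPrefix r₂ _ := by simpa [isPrefix] using h'
      simp [merge, isPrefix, ihl hl hl₂, ihr hr hr₂]

/-! ### The rewrite relation, inductively -/

/-- One rewrite step by a rule of `ruleList`. -/
inductive Red : BTree → BTree → Prop
  | root {s s' t : BTree} (h : (s, s') ∈ ruleList) (hs : isPrefix s t) :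
      Red t (s'.multigraft (cut s t))
  | left {l l₂ : BTree} (r : BTree) (h : Red l l₂) : Red (node l r) (node l₂ r)
  | right (l : BTree) {r r₂ : BTree} (h : Red r r₂) : Red (node l r) (node l r₂)

/-- Iterated rewriting. -/
abbrev Reds : BTree → BTree → Prop := Relation.ReflTransGen Red

lemma Red.arity_eq {t t' : BTree} (h : Red t t') : t.arity = t'.arity := by
  induction h with
  | root h hs => exact (arity_multigraft_cut hs (arity_eq_of_mem_ruleList _ h)).symm
  | left r _ ih => simp [arity, ih]
  | right l _ ih => simp [arity, ih]

lemma Reds.arity_eq {t t' : BTree} (h : Reds t t') : t.arity = t'.arity := by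
  induction h with
  | refl => rfl
  | tail _ h ih => exact ih.trans h.arity_eq

lemma Reds.node {l l' r r' : BTree} (hl : Reds l l') (hr : Reds r r') :
    Reds (node l r) (node l' r') :=
  (hl.lift (BTree.node · r) fun _ _ => Red.left r).trans
    (hr.lift (BTree.node l') fun _ _ => Red.right l')

lemma Red.multigraft {t t' : BTree} (h : Red t t') {xs : List BTree}
    (hx : xs.length = t.arity) : Red (t.multigraft xs) (t'.multigraft xs) := by
  induction h generalizing xs with
  | @root s s' t h hs =>
    have hp := isPrefix_multigraft t xs
    have key := multigraft_cut_multigraft_cut hs hp (arity_eq_of_mem_ruleList _ h)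
    rw [cut_multigraft hx] at key
    rw [key]
    exact .root h (isPrefix_trans hs hp)
  | left r h ih =>
    obtain ⟨ys, zs, rfl, hy, hz⟩ := exists_append_of_length_eq_add hx
    rw [multigraft_node_append hy, multigraft_node_append (hy.trans h.arity_eq)]
    exact .left _ (ih hy)
  | right l h ih =>
    obtain ⟨ys, zs, rfl, hy, hz⟩ := exists_append_of_length_eq_add hx
    rw [multigraft_node_append hy, multigraft_node_append hy]
    exact .right _ (ih hz)

lemma Reds.multigraft {t t' : BTree} (h : Reds t t') {xs : List BTree}
    (hx : xs.length = t.arity) : Reds (t.multigraft xs) (t'.multigraft xs) := by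
  induction h with
  | refl => exact .refl
  | tail h₁ h₂ ih => exact ih.tail (h₂.multigraft (hx.trans (Reds.arity_eq h₁)))

lemma reds_multigraft_of_forall₂ (u : BTree) {xs ys : List BTree} (h : List.Forall₂ Reds xs ys) :
    Reds (u.multigraft xs) (u.multigraft ys) := by
  induction u generalizing xs ys with
  | leaf => cases h with
    | nil => exact .refl
    | cons h _ => exact h
  | node l r ihl ihr => exact (ihl (List.forall₂_take _ h)).node (ihr (List.forall₂_drop _ h))

lemma forall₂_reds_refl (xs : List BTree) : List.Forall₂ Reds xs xs :=
  List.forall₂_same.2 fun _ _ => .refl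

/-! ### Termination -/

/-- `X` multiplied by `2 ^ t.arity`. -/
def scale (t : BTree) (X : ℕ) : ℕ := 2 ^ t.arity * X

lemma scale_node (l r : BTree) (X : ℕ) : scale (node l r) X = scale l (scale r X) := by
  simp only [scale, arity, pow_add, mul_assoc]

lemma two_mul_le_scale (t : BTree) (X : ℕ) : 2 * X ≤ scale t X :=
  Nat.mul_le_mul_right X (Nat.le_self_pow (arity_pos t).ne' 2)

lemma scale_pos (t : BTree) {X : ℕ} (h : 0 < X) : 0 < scale t X :=
  Nat.mul_pos (Nat.two_pow_pos _) h

/-- The sum, over the internal nodes of `t`, of `2 ^ k * X`, where `k` is the number of leaves of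
`t` which are not to the left of the node. -/
def weight : BTree → ℕ → ℕ
  | leaf, _ => 0
  | node l r, X => scale l (scale r X) + weight l (scale r X) + weight r X

lemma weight_multigraft_lt {s s' : BTree} (h : (s, s') ∈ ruleList) {xs : List BTree}
    (hx : xs.length = s.arity) {X : ℕ} (hX : 0 < X) :
    weight (s'.multigraft xs) X < weight (s.multigraft xs) X := by
  simp only [ruleList, List.mem_cons, Prod.mk.injEq, List.not_mem_nil, or_false] at h
  rcases h with ⟨rfl, rfl⟩ | ⟨rfl, rfl⟩ | ⟨rfl, rfl⟩ | ⟨rfl, rfl⟩ | ⟨rfl, rfl⟩ | ⟨rfl, rfl⟩ | ⟨rfl, rfl⟩ | ⟨rfl, rfl⟩ | ⟨rfl, rfl⟩ | ⟨rfl, rfl⟩ | ⟨rfl, rfl⟩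
  · match xs, hx with
    | [a, b, c, d], _ =>
      simp [multigraft, arity, weight, scale_node]
      grind [two_mul_le_scale]
  · match xs, hx with
    | [a, b, c, d, e], _ =>
      simp [multigraft, arity, weight, scale_node]
      grind [two_mul_le_scale]
  · match xs, hx with
    | [a, b, c, d, e, f], _ =>
      simp [multigraft, arity, weight, scale_node]
      grind [two_mul_le_scale]
  · match xs, hx with
    | [a, b, c, d, e, f], _ =>
      simp [multigraft, arity, weight, scale_node]
      grind [two_mul_le_scale]
  · match xs, hx with
    | [a, b, c, d, e, f, g], _ =>
      simp [multigraft, arity, weight, scale_node]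
      grind [two_mul_le_scale]
  · match xs, hx with
    | [a, b, c, d, e, f, g], _ =>
      simp [multigraft, arity, weight, scale_node]
      grind [two_mul_le_scale]
  · match xs, hx with
    | [a, b, c, d, e, f, g], _ =>
      simp [multigraft, arity, weight, scale_node]
      grind [two_mul_le_scale]
  · match xs, hx with
    | [a, b, c, d, e, f, g, h], _ =>
      simp [multigraft, arity, weight, scale_node]
      grind [two_mul_le_scale]
  · match xs, hx with
    | [a, b, c, d, e, f, g, h], _ =>
      simp [multigraft, arity, weight, scale_node]
      grind [two_mul_le_scale]
  · match xs, hx with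
    | [a, b, c, d, e, f, g, h], _ =>
      simp [multigraft, arity, weight, scale_node]
      grind [two_mul_le_scale]
  · match xs, hx with
    | [a, b, c, d, e, f, g, h], _ =>
      simp [multigraft, arity, weight, scale_node]
      grind [two_mul_le_scale]

lemma Red.weight_lt {t t' : BTree} (h : Red t t') {X : ℕ} (hX : 0 < X) :
    weight t' X < weight t X := by
  induction h generalizing X with
  | root h hs => simpa only [multigraft_cut hs] using weight_multigraft_lt h (length_cut hs) hX
  | left r _ ih =>
    rename_i h
    have := ih (scale_pos r hX)
    have : scale _ (scale r X) = scale _ (scale r X) := congrArg (2 ^ · * scale r X) h.arity_eq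
    simp only [weight]
    lia
  | right l _ ih =>
    rename_i h
    have := ih hX
    have : scale _ X = scale _ X := congrArg (2 ^ · * X) h.arity_eq
    simp only [weight, ← this]
    lia

/-! ### Local confluence -/

/-- Apply `k` to `t`, after `t` has been brought to constructor form: this makes the kernel
evaluate `t` only once. -/
def force {β : Type} : BTree → (BTree → β) → β
  | leaf, k => k leaf
  | node l r, k => force l fun l' => force r fun r' => k (node l' r')

lemma force_eq {β : Type} (t : BTree) (k : BTree → β) : force t k = k t := by
  induction t generalizing k with
  | leaf => rfl
  | node l r ihl ihr => rw [force, ihl, ihr]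

/-- A normal form of a tree, provided that the number `n` is large enough. -/
def normalize : ℕ → BTree → BTree
  | 0, t => t
  | _ + 1, leaf => leaf
  | n + 1, node l r =>
      force (normalize n l) fun l' => force (normalize n r) fun r' =>
        match ruleList.find? fun p => isPrefix p.1 (node l' r') with
        | none => node l' r'
        | some p => force (p.2.multigraft (cut p.1 (node l' r'))) (normalize n)

lemma reds_normalize (n : ℕ) (t : BTree) : Reds t (normalize n t) := by
  induction n generalizing t with
  | zero => exact .refl
  | succ n ih =>
    cases t with
    | leaf => exact .refl
    | node l r =>
      refine ((ih l).node (ih r)).trans ?_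
      simp only [normalize, force_eq]
      split
      · exact .refl
      · rename_i p hp
        exact .head (.root (List.mem_of_find?_eq_some hp) (List.find?_some (p := fun p : BTree × BTree =>
          isPrefix p.1 (node (normalize n l) (normalize n r))) hp)) (ih _)

/-- The pairs `(m, m')` where `m` is a minimal tree having `s` as a prefix and on which a rule
can be applied at an internal node of `s`, the result being `m'`. -/
def overlaps : BTree → List (BTree × BTree)
  | leaf => []
  | node l r =>
      ruleList.map (fun p =>
        let m := merge (node l r) p.1
        (m, p.2.multigraft (cut p.1 m))) ++
      ((overlaps l).map (fun q => (node q.1 r, node q.2 r)) ++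
      (overlaps r).map (fun q => (node l q.1, node l q.2)))

/-- Equality test for binary trees. -/
def equal : BTree → BTree → Bool
  | leaf, leaf => true
  | node l r, node l' r' => equal l l' && equal r r'
  | _, _ => false

lemma eq_of_equal {s t : BTree} (h : equal s t) : s = t := by
  induction s generalizing t with
  | leaf => cases t <;> simp_all [equal]
  | node l r ihl ihr =>
    cases t with
    | leaf => simp [equal] at h
    | node l' r' =>
      simp only [equal, Bool.and_eq_true] at h
      rw [ihl h.1, ihr h.2]

lemma equal_normalize_overlaps :
    (ruleList.all fun p => (overlaps p.1).all fun q =>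
      force q.1 fun m => force q.2 fun m' =>
        equal (normalize 40 (p.2.multigraft (cut p.1 m))) (normalize 40 m')) = true := by
  decide +kernel

lemma join_of_mem_overlaps {s s' m m' : BTree} (h : (s, s') ∈ ruleList)
    (hm : (m, m') ∈ overlaps s) : Relation.Join Reds (s'.multigraft (cut s m)) m' := by
  have := List.all_eq_true.1 (List.all_eq_true.1 equal_normalize_overlaps _ h) _ hm
  simp only [force_eq] at this
  exact ⟨_, reds_normalize 40 _, eq_of_equal this ▸ reds_normalize 40 _⟩

lemma Red.overlaps_or_forall₂ {s t t' : BTree} (h : Red t t') (hs : isPrefix s t) :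
    (∃ m m', (m, m') ∈ overlaps s ∧ m.arity = m'.arity ∧ isPrefix s m ∧ isPrefix m t ∧
      t' = m'.multigraft (cut m t)) ∨
    (isPrefix s t' ∧ List.Forall₂ Reds (cut s t) (cut s t')) := by
  induction s generalizing t t' with
  | leaf => exact .inr ⟨rfl, .cons (.single h) .nil⟩
  | node a b iha ihb =>
    obtain ⟨l, r, rfl, hl, hr⟩ := exists_of_isPrefix_node hs
    cases h with
    | @root s₂ s₂' _ h₂ hs₂ =>
      have hm := merge_isPrefix hs hs₂
      have hm₂ := isPrefix_merge_right (node a b) s₂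
      have har := arity_eq_of_mem_ruleList _ h₂
      exact .inl ⟨_, _, List.mem_append_left _ (List.mem_map_of_mem h₂),
        (arity_multigraft_cut hm₂ har).symm, isPrefix_merge_left _ _, hm,
        (multigraft_cut_multigraft_cut hm₂ hm har).symm⟩
    | left _ h =>
      obtain ⟨m, m', h₁, h₂, h₃, h₄, rfl⟩ | ⟨h₁, h₂⟩ := iha h hl
      · refine .inl ⟨node m b, node m' b, List.mem_append_right _ (List.mem_append_left _
          (List.mem_map_of_mem h₁)), by simp [arity, h₂], by simp [isPrefix, h₃, isPrefix_refl],
          by simp [isPrefix, h₄, hr], ?_⟩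
        rw [cut, multigraft_node_append ((length_cut h₄).trans h₂), multigraft_cut hr]
      · exact .inr ⟨by simp [isPrefix, h₁, hr], List.rel_append h₂ (forall₂_reds_refl _)⟩
    | right _ h =>
      obtain ⟨m, m', h₁, h₂, h₃, h₄, rfl⟩ | ⟨h₁, h₂⟩ := ihb h hr
      · refine .inl ⟨node a m, node a m', List.mem_append_right _ (List.mem_append_right _
          (List.mem_map_of_mem h₁)), by simp [arity, h₂], by simp [isPrefix, h₃, isPrefix_refl],
          by simp [isPrefix, h₄, hl], ?_⟩
        rw [cut, multigraft_node_append (length_cut hl), multigraft_cut hl]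
      · exact .inr ⟨by simp [isPrefix, h₁, hl], List.rel_append (forall₂_reds_refl _) h₂⟩

lemma Red.join_root {s s' t t' : BTree} (h : Red t t') (hr : (s, s') ∈ ruleList)
    (hs : isPrefix s t) : Relation.Join Reds (s'.multigraft (cut s t)) t' := by
  have har := arity_eq_of_mem_ruleList _ hr
  obtain ⟨m, m', h₁, h₂, h₃, h₄, rfl⟩ | ⟨h₁, h₂⟩ := h.overlaps_or_forall₂ hs
  · obtain ⟨c, hc, hc'⟩ := join_of_mem_overlaps hr h₁
    rw [← multigraft_cut_multigraft_cut h₃ h₄ har]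
    have hlen := length_cut h₄
    exact ⟨_, hc.multigraft (hlen.trans (arity_multigraft_cut h₃ har).symm),
      hc'.multigraft (hlen.trans h₂)⟩
  · refine ⟨_, reds_multigraft_of_forall₂ s' h₂, .single ?_⟩
    exact .root hr h₁

lemma Red.join {t a b : BTree} (ha : Red t a) (hb : Red t b) : Relation.Join Reds a b := by
  induction ha generalizing b with
  | root hr hs => exact hb.join_root hr hs
  | left r h ih =>
    cases hb with
    | root hr hs => exact symm ((Red.left r h).join_root hr hs)
    | left _ h' =>
      obtain ⟨c, hc, hc'⟩ := ih h'
      exact ⟨_, hc.node .refl, hc'.node .refl⟩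
    | right _ h' => exact ⟨_, .single (.right _ h'), .single (.left _ h)⟩
  | right l h ih =>
    cases hb with
    | root hr hs => exact symm ((Red.right l h).join_root hr hs)
    | left _ h' => exact ⟨_, .single (.left _ h'), .single (.right _ h)⟩
    | right _ h' =>
      obtain ⟨c, hc, hd⟩ := ih h'
      exact ⟨_, Reds.node .refl hc, Reds.node .refl hd⟩

/-! ### Normal forms -/

/-- No rule of `ruleList` applies to `t`. -/
def IsNormal (t : BTree) : Prop := ∀ t', ¬ Red t t'

lemma exists_isNormal (t : BTree) : ∃ u, IsNormal u ∧ Reds t u := by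
  induction hn : weight t 1 using Nat.strong_induction_on generalizing t with
  | _ n ih =>
    by_cases h : IsNormal t
    · exact ⟨t, h, .refl⟩
    · simp only [IsNormal, not_forall, not_not] at h
      obtain ⟨t', h⟩ := h
      obtain ⟨u, hu, h'⟩ := ih _ (hn ▸ h.weight_lt Nat.one_pos) t' rfl
      exact ⟨u, hu, .head h h'⟩

lemma IsNormal.eq_of_reds {u v : BTree} (hu : IsNormal u) (h : Reds u v) : u = v := by
  obtain rfl | ⟨c, hc, -⟩ := h.cases_head
  · rfl
  · exact (hu c hc).elim

lemma IsNormal.unique {t u v : BTree} (hu : IsNormal u) (hv : IsNormal v) (htu : Reds t u)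
    (htv : Reds t v) : u = v := by
  induction hn : weight t 1 using Nat.strong_induction_on generalizing t u v with
  | _ n ih =>
    obtain rfl | ⟨a, ha, hau⟩ := htu.cases_head
    · exact hu.eq_of_reds htv
    obtain rfl | ⟨b, hb, hbv⟩ := htv.cases_head
    · exact (hv.eq_of_reds htu).symm
    obtain ⟨c, hac, hbc⟩ := ha.join hb
    obtain ⟨w, hw, hcw⟩ := exists_isNormal c
    exact (ih _ (hn ▸ ha.weight_lt Nat.one_pos) hu hw hau (hac.trans hcw) rfl).trans
      (ih _ (hn ▸ hb.weight_lt Nat.one_pos) hv hw hbv (hbc.trans hcw) rfl).symm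

lemma IsNormal.eq_of_eqvGen {t t' u v : BTree} (h : Relation.EqvGen Red t t') (hu : IsNormal u)
    (hv : IsNormal v) (htu : Reds t u) (htv : Reds t' v) : u = v := by
  induction h generalizing u v with
  | rel _ _ h => exact hu.unique hv htu (.head h htv)
  | refl _ => exact hu.unique hv htu htv
  | symm _ _ _ ih => exact (ih hv hu htv htu).symm
  | trans _ y _ _ _ ih ih' =>
    obtain ⟨w, hw, h⟩ := exists_isNormal y
    exact (ih hu hw htu h).trans (ih' hw hv h htv)

/-! ### The rules are consequences of `L_3 ≡ R_3` -/

/-- The identity `((a * b) * c) * d = a * (b * (c * d))`. -/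
def CombAssoc (M : Type*) [Mul M] : Prop :=
  ∀ a b c d : M, ((a * b) * c) * d = a * (b * (c * d))

section CombAssoc

variable {M : Type*} [Mul M]

lemma CombAssoc.mul_eq_of_220202000 (H : CombAssoc M) (a b c d e : M) :
    (a * (b * (c * d))) * e =
      (a * b) * (c * (d * e)) := by
  rw [← H a b c d, H (a * b) c d e]

lemma CombAssoc.mul_eq_of_20202202000 (H : CombAssoc M) (a b c d e f : M) :
    a * (b * ((c * (d * e)) * f)) =
      a * (b * (c * (d * (e * f)))) := by
  rw [← H a b (c * (d * e)) f, ← H (a * b) c d e, H ((a * b) * c) d e f, H a b c (d * (e * f))]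

lemma CombAssoc.mul_eq_of_20220200200 (H : CombAssoc M) (a b c d e f : M) :
    a * ((b * (c * d)) * (e * f)) =
      a * (b * (c * (d * (e * f)))) := by
  rw [← H a (b * (c * d)) e f, ← H a b c d, H ((a * b) * c) d e f, H a b c (d * (e * f))]

lemma CombAssoc.mul_eq_of_2020220020200 (H : CombAssoc M) (a b c d e f g : M) :
    a * (b * ((c * d) * (e * (f * g)))) =
      a * (b * (c * (d * ((e * f) * g)))) := by
  rw [← H a b (c * d) (e * (f * g)), ← H ((a * b) * (c * d)) e f g, H (a * b) (c * d) e f,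
    H a b ((c * d) * (e * f)) g, H c d (e * f) g]

lemma CombAssoc.mul_eq_of_2022002020200 (H : CombAssoc M) (a b c d e f g : M) :
    a * ((b * c) * (d * (e * (f * g)))) =
      a * (b * (c * ((d * e) * (f * g)))) := by
  rw [← H a (b * c) d (e * (f * g)), ← H ((a * (b * c)) * d) e f g, H a (b * c) d e,
    H a ((b * c) * (d * e)) f g, H b c (d * e) (f * g)]

lemma CombAssoc.mul_eq_of_2202200020200 (H : CombAssoc M) (a b c d e f g : M) :
    (a * ((b * c) * d)) * (e * (f * g)) =
      (a * b) * (c * (d * (e * (f * g)))) := by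
  rw [← H (a * ((b * c) * d)) e f g, H a ((b * c) * d) e f, H b c d (e * f), ← H c d e f,
    ← H a b ((c * d) * e) f, H (a * b) ((c * d) * e) f g, H c d e (f * g)]

lemma CombAssoc.mul_eq_of_202020202200200 (H : CombAssoc M) (a b c d e f g h : M) :
    a * (b * (c * (d * ((e * f) * (g * h))))) =
      a * (b * (c * (d * (e * ((f * g) * h))))) := by
  rw [← H c d (e * f) (g * h), ← H a b ((c * d) * (e * f)) (g * h), ← H (a * b) (c * d) e f,
    H a b (c * d) e, H a (b * ((c * d) * e)) f (g * h), ← H (b * ((c * d) * e)) f g h,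
    H b ((c * d) * e) f g, H c d e (f * g), ← H d e f g, ← H b c ((d * e) * f) g,
    H (b * c) ((d * e) * f) g h, H d e f (g * h), ← H a (b * c) d (e * (f * (g * h))),
    ← H ((a * (b * c)) * d) e f (g * h), H a (b * c) d e, H a ((b * c) * (d * e)) f (g * h),
    ← H ((b * c) * (d * e)) f g h, H (b * c) (d * e) f g, H b c ((d * e) * (f * g)) h,
    H d e (f * g) h]

lemma CombAssoc.mul_eq_of_202020220022000 (H : CombAssoc M) (a b c d e f g h : M) :
    a * (b * (c * ((d * e) * ((f * g) * h)))) =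
      a * (b * (c * (d * (e * (f * (g * h)))))) := by
  rw [← H c (d * e) (f * g) h, ← H a b ((c * (d * e)) * (f * g)) h, ← H (a * b) (c * (d * e)) f g,
    ← H (a * b) c d e, H ((((a * b) * c) * d) * e) f g h, H ((a * b) * c) d e (f * (g * h)),
    H a b c (d * (e * (f * (g * h))))]

lemma CombAssoc.mul_eq_of_220020202200200 (H : CombAssoc M) (a b c d e f g h : M) :
    (a * b) * (c * (d * ((e * f) * (g * h)))) =
      (a * b) * (c * (d * (e * ((f * g) * h)))) := by
  rw [← H d (e * f) g h, ← H (a * b) c ((d * (e * f)) * g) h, H a b c ((d * (e * f)) * g),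
    ← H b c (d * (e * f)) g, ← H (b * c) d e f, H b c d e, H b (c * (d * e)) f g,
    ← H a b (c * (d * e)) (f * g), ← H (a * b) c d e, H (((a * b) * c) * d) e (f * g) h,
    H (a * b) c d (e * ((f * g) * h))]

lemma CombAssoc.mul_eq_of_220200202020200 (H : CombAssoc M) (a b c d e f g h : M) :
    (a * (b * c)) * (d * (e * (f * (g * h)))) =
      (a * b) * (c * (d * (e * ((f * g) * h)))) := by
  rw [← H (a * (b * c)) d e (f * (g * h)), H a (b * c) d e, ← H (a * ((b * c) * (d * e))) f g h,
    H a ((b * c) * (d * e)) f g, H b c (d * e) (f * g), ← H a b c ((d * e) * (f * g)),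
    H (a * b) c ((d * e) * (f * g)) h, H d e (f * g) h]

end CombAssoc

lemma graft_node_left {l r s : BTree} {i : ℕ} (h : i ≤ l.arity) :
    (node l r).graft i s = node (l.graft i s) r := by
  simp [graft, h]

lemma graft_node_right {l r s : BTree} {i : ℕ} (h : 1 ≤ i) :
    (node l r).graft (i + l.arity) s = node l (r.graft i s) := by
  simp [graft, Nat.one_le_iff_ne_zero.1 h]

lemma step_node_left {R : BTree → BTree → Prop} {l l' : BTree} (r : BTree) (h : Step R l l') :
    Step R (node l r) (node l' r) := by
  obtain ⟨s, s', u, i, xs, hR, h1, h2, hx, rfl, rfl⟩ := h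
  exact ⟨s, s', node u r, i, xs, hR, h1, h2.trans (Nat.le_add_right _ _), hx,
    (graft_node_left h2).symm, (graft_node_left h2).symm⟩

lemma step_node_right {R : BTree → BTree → Prop} (l : BTree) {r r' : BTree} (h : Step R r r') :
    Step R (node l r) (node l r') := by
  obtain ⟨s, s', u, i, xs, hR, h1, h2, hx, rfl, rfl⟩ := h
  exact ⟨s, s', node l u, i + l.arity, xs, hR, by lia, by simp only [arity]; lia, hx,
    (graft_node_right h1).symm, (graft_node_right h1).symm⟩

lemma step_multigraft {R : BTree → BTree → Prop} {s s' : BTree} {xs : List BTree}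
    (h : R s s') (hx : xs.length = s.arity) : Step R (s.multigraft xs) (s'.multigraft xs) :=
  ⟨s, s', leaf, 1, xs, h, le_rfl, le_rfl, hx, by simp [graft], by simp [graft]⟩

lemma Red.graft {t t' : BTree} (h : Red t t') (r : BTree) {i : ℕ} (h1 : 1 ≤ i)
    (h2 : i ≤ r.arity) : Red (r.graft i t) (r.graft i t') := by
  induction r generalizing i with
  | leaf =>
    obtain rfl : i = 1 := le_antisymm h2 h1
    simpa [BTree.graft] using h
  | node l r ihl ihr =>
    simp only [arity] at h2
    simp only [BTree.graft]
    split
    · exact .left _ (ihl h1 ‹_›)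
    · exact .right _ (ihr (by lia) (by lia))

lemma red_iff_step {t t' : BTree} : Red t t' ↔ Step Rules3 t t' := by
  constructor
  · intro h
    induction h with
    | root h hs =>
      simpa only [multigraft_cut hs] using step_multigraft (mem_ruleList_iff.1 h) (length_cut hs)
    | left r _ ih => exact step_node_left r ih
    | right l _ ih => exact step_node_right l ih
  · rintro ⟨s, s', r, i, xs, hR, h1, h2, hx, rfl, rfl⟩
    refine Red.graft ?_ r h1 h2
    simpa only [cut_multigraft hx] using Red.root hR (isPrefix_multigraft s xs)

lemma isNormal_iff {u : BTree} : IsNormal u ↔ ∀ s s', Rules3 s s' → ¬ Occurs s u := by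
  refine ⟨fun h s s' hR => ?_, fun h u' hu => ?_⟩
  · rintro ⟨r, i, xs, h1, h2, hx, rfl⟩
    exact h _ (red_iff_step.2 ⟨s, s', r, i, xs, hR, h1, h2, hx, rfl, rfl⟩)
  · obtain ⟨s, s', r, i, xs, hR, h1, h2, hx, rfl, -⟩ := red_iff_step.1 hu
    exact h s s' hR ⟨r, i, xs, h1, h2, hx, rfl⟩

/-- The congruence `≡_γ` on the magma of binary trees. -/
def combCon (γ : ℕ) : Con BTree where
  r := CAsCongr γ
  iseqv := Relation.EqvGen.is_equivalence _
  mul' {w x y z} hwx hyz := by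
    have hl : CAsCongr γ (node w y) (node x y) := by
      induction hwx with
      | rel _ _ h => exact .rel _ _ (step_node_left y h)
      | refl _ => exact .refl _
      | symm _ _ _ ih => exact .symm _ _ ih
      | trans _ _ _ _ _ ih ih' => exact .trans _ _ _ ih ih'
    have hr : CAsCongr γ (node x y) (node x z) := by
      clear hl
      induction hyz with
      | rel _ _ h => exact .rel _ _ (step_node_right x h)
      | refl _ => exact .refl _
      | symm _ _ _ ih => exact .symm _ _ ih
      | trans _ _ _ _ _ ih ih' => exact .trans _ _ _ ih ih'
    exact .trans _ _ _ hl hr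

lemma combAssoc_quotient : CombAssoc (combCon 3).Quotient := by
  rintro ⟨a⟩ ⟨b⟩ ⟨c⟩ ⟨d⟩
  exact (combCon 3).eq.2 (.rel _ _ (step_multigraft (s := leftComb 3) (s' := rightComb 3)
    (xs := [a, b, c, d]) ⟨rfl, rfl⟩ rfl))

lemma combCon_multigraft {s s' : BTree} (h : (s, s') ∈ ruleList) {xs : List BTree}
    (hx : xs.length = s.arity) :
    (s.multigraft xs : (combCon 3).Quotient) = (s'.multigraft xs : (combCon 3).Quotient) := by
  have H := combAssoc_quotient
  simp only [ruleList, List.mem_cons, Prod.mk.injEq, List.not_mem_nil, or_false] at h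
  rcases h with ⟨rfl, rfl⟩ | ⟨rfl, rfl⟩ | ⟨rfl, rfl⟩ | ⟨rfl, rfl⟩ | ⟨rfl, rfl⟩ | ⟨rfl, rfl⟩ | ⟨rfl, rfl⟩ | ⟨rfl, rfl⟩ | ⟨rfl, rfl⟩ | ⟨rfl, rfl⟩ | ⟨rfl, rfl⟩
  · match xs, hx with
    | [a, b, c, d], _ => exact H a b c d
  · match xs, hx with
    | [a, b, c, d, e], _ => exact H.mul_eq_of_220202000 a b c d e
  · match xs, hx with
    | [a, b, c, d, e, f], _ => exact H.mul_eq_of_20202202000 a b c d e f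
  · match xs, hx with
    | [a, b, c, d, e, f], _ => exact H.mul_eq_of_20220200200 a b c d e f
  · match xs, hx with
    | [a, b, c, d, e, f, g], _ => exact H.mul_eq_of_2020220020200 a b c d e f g
  · match xs, hx with
    | [a, b, c, d, e, f, g], _ => exact H.mul_eq_of_2022002020200 a b c d e f g
  · match xs, hx with
    | [a, b, c, d, e, f, g], _ => exact H.mul_eq_of_2202200020200 a b c d e f g
  · match xs, hx with
    | [a, b, c, d, e, f, g, h], _ => exact H.mul_eq_of_202020202200200 a b c d e f g h
  · match xs, hx with
    | [a, b, c, d, e, f, g, h], _ => exact H.mul_eq_of_202020220022000 a b c d e f g h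
  · match xs, hx with
    | [a, b, c, d, e, f, g, h], _ => exact H.mul_eq_of_220020202200200 a b c d e f g h
  · match xs, hx with
    | [a, b, c, d, e, f, g, h], _ => exact H.mul_eq_of_220200202020200 a b c d e f g h

lemma Red.caCongr {t t' : BTree} (h : Red t t') : CAsCongr 3 t t' := by
  induction h with
  | root h hs =>
    have := (combCon 3).eq.1 (combCon_multigraft h (length_cut hs))
    rwa [multigraft_cut hs] at this
  | left r _ ih => exact (combCon 3).mul ih ((combCon 3).refl r)
  | right l _ ih => exact (combCon 3).mul ((combCon 3).refl l) ih

lemma Reds.caCongr {t t' : BTree} (h : Reds t t') : CAsCongr 3 t t' := by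
  induction h with
  | refl => exact .refl _
  | tail _ h ih => exact .trans _ _ _ ih h.caCongr

lemma eqvGen_red_of_caCongr {t t' : BTree} (h : CAsCongr 3 t t') : Relation.EqvGen Red t t' := by
  refine Relation.EqvGen.mono (fun a b hab => red_iff_step.2 ?_) _ _ h
  obtain ⟨s, s', r, i, xs, ⟨rfl, rfl⟩, h⟩ := hab
  exact ⟨_, _, r, i, xs, List.mem_cons_self, h⟩

end BTree

/-- Every `≡₃`-class contains exactly one tree avoiding the eleven left members
of the rules of `Rules3`: a Poincaré–Birkhoff–Witt basis of `CAs₃`. -/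
theorem stmt9 (t : BTree) :
    ∃! u : BTree, CAsCongr 3 t u ∧ ∀ s s', Rules3 s s' → ¬ Occurs s u := by
  simp only [← BTree.isNormal_iff]
  obtain ⟨u, hu, htu⟩ := BTree.exists_isNormal t
  refine ⟨u, ⟨htu.caCongr, hu⟩, fun v ⟨htv, hv⟩ => ?_⟩
  exact (hu.eq_of_eqvGen (BTree.eqvGen_red_of_caCongr htv) hv htu .refl).symm
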